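/- Let G be a simple graph with n ≥ 5 vertices satisfying δ(G) ≥ n/2. Then the H-force number h(G) equals n − 2, or n/2, or n. Moreover, if h(G) = n − 2, then V(G) \ {x, y} is an H-force set of minimum cardinality, where x, y are vertices of degree n − 1 in the weak closure C_w(G); if h(G) = n/2, then the largest independent set of C_w(G) is an H-force set of minimum cardinality; if h(G) = n, then V(G) is the only H-force set. -/

import Mathlib

open Finset SimpleGraph
open scoped Classical

/-- `X` is a Hamiltonian cycle enforcing set (H-force set) of `G`: `X` is nonempty and
every cycle of `G` containing all vertices of `X` is a Hamiltonian cycle. -/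
def IsHForceSet {V : Type*} [Fintype V] [DecidableEq V] (G : SimpleGraph V)
    (X : Finset V) : Prop :=
  X.Nonempty ∧ ∀ (v : V) (c : G.Walk v v), c.IsCycle → (∀ x ∈ X, x ∈ c.support) →
    c.IsHamiltonianCycle

/-- The H-force number of `G`: the smallest cardinality of an H-force set of `G`. -/
noncomputable def hForce {V : Type*} [Fintype V] [DecidableEq V] (G : SimpleGraph V) : ℕ :=
  sInf {k | ∃ X : Finset V, IsHForceSet G X ∧ X.card = k}

/-- `X` is an H-force set of `G` of minimum cardinality. -/
def IsMinHForceSet {V : Type*} [Fintype V] [DecidableEq V] (G : SimpleGraph V)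
    (X : Finset V) : Prop :=
  IsHForceSet G X ∧ ∀ Y : Finset V, IsHForceSet G Y → X.card ≤ Y.card

/-- One step of the weak-closure process: `H` is obtained from `G` by joining one pair of
nonadjacent vertices whose degree sum is at least `n + 1`. -/
def WeakStep {V : Type*} [Fintype V] (G H : SimpleGraph V) : Prop :=
  ∃ u v : V, u ≠ v ∧ ¬G.Adj u v ∧ Fintype.card V + 1 ≤ G.degree u + G.degree v ∧
    H = G ⊔ SimpleGraph.edge u v

/-- `H` is a weak closure of `G`: it is obtained from `G` by a finite sequence of weak-closure
steps, and no pair of nonadjacent vertices of `H` has degree sum at least `n + 1`. -/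
def IsWeakClosure {V : Type*} [Fintype V] (G H : SimpleGraph V) : Prop :=
  Relation.ReflTransGen WeakStep G H ∧
    ∀ u v : V, u ≠ v → ¬H.Adj u v → H.degree u + H.degree v < Fintype.card V + 1

section CycleLists

variable {W : Type*} {H : SimpleGraph W}

/-- A list of distinct vertices, each adjacent to the next one. -/
def IsPathList (H : SimpleGraph W) (l : List W) : Prop :=
  l.Nodup ∧ l.IsChain H.Adj

/-- A list of distinct vertices, each adjacent to the next one, the last adjacent to the first. -/
def IsCycleList (H : SimpleGraph W) (l : List W) : Prop :=
  IsPathList H l ∧ ∀ x ∈ l.getLast?, ∀ y ∈ l.head?, H.Adj x y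

lemma isChain_adj_reverse {l : List W} : l.reverse.IsChain H.Adj ↔ l.IsChain H.Adj := by
  rw [List.isChain_reverse]
  exact List.IsChain.iff fun a b => H.adj_comm b a

lemma IsPathList.reverse {l : List W} (h : IsPathList H l) : IsPathList H l.reverse :=
  ⟨List.nodup_reverse.2 h.1, isChain_adj_reverse.2 h.2⟩

lemma IsCycleList.append_comm {a b : List W} (h : IsCycleList H (a ++ b)) :
    IsCycleList H (b ++ a) := by
  obtain ⟨⟨h1, h2⟩, h3⟩ := h
  rcases List.eq_nil_or_concat' a with rfl | ⟨a', x, rfl⟩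
  · rw [List.append_nil]; exact ⟨⟨h1, h2⟩, h3⟩
  cases b with
  | nil => rw [List.append_nil] at h1 h2 h3; exact ⟨⟨h1, h2⟩, h3⟩
  | cons y b' =>
    refine ⟨⟨(List.perm_append_comm.nodup_iff).1 h1, ?_⟩, ?_⟩
    · rw [List.isChain_append] at h2 ⊢
      refine ⟨h2.2.1, h2.1, fun u hu v hv => h3 u ?_ v ?_⟩
      · rwa [List.getLast?_append_of_ne_nil _ (by simp)]
      · rwa [List.head?_append_of_ne_nil _ (by simp)]
    · intro u hu v hv
      rw [List.isChain_append] at h2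
      refine h2.2.2 u ?_ v ?_
      · rwa [← List.append_assoc, List.getLast?_concat, ← List.getLast?_concat] at hu
      · simpa using hv

/-- Reversing an initial segment of a path closes it up into a cycle. -/
lemma IsPathList.isCycleList_reverse_append {a b : List W} (h : IsPathList H (a ++ b))
    (hb : b ≠ []) (h1 : ∀ x ∈ a.head?, ∀ y ∈ b.head?, H.Adj x y)
    (h2 : ∀ x ∈ a.getLast?, ∀ y ∈ b.getLast?, H.Adj x y) (ha : a ≠ []) :
    IsCycleList H (a.reverse ++ b) := by
  obtain ⟨hn, hc⟩ := h
  rw [List.isChain_append] at hc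
  refine ⟨⟨?_, ?_⟩, ?_⟩
  · rw [List.nodup_append] at hn ⊢
    simpa using hn
  · rw [List.isChain_append]
    refine ⟨isChain_adj_reverse.2 hc.1, hc.2.1, ?_⟩
    simpa using h1
  · intro x hx y hy
    refine (h2 y ?_ x ?_).symm
    · cases h : a.getLast? <;> simp_all
    · cases h : b.getLast? <;> simp_all

/-- A vertex adjacent to two vertices of a cycle whose successors are adjacent, or which are
consecutive, can be inserted. -/
lemma IsCycleList.insert_crossing {a b : List W} {u : W} (h : IsCycleList H (a ++ b))
    (hu : u ∉ a ++ b) (ha : a ≠ []) (hb : b ≠ [])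
    (h1 : ∀ x ∈ a.head?, ∀ y ∈ b.head?, H.Adj x y)
    (h2 : ∀ x ∈ a.getLast?, H.Adj u x) (h3 : ∀ x ∈ b.getLast?, H.Adj u x) :
    IsCycleList H (u :: (a.reverse ++ b)) := by
  obtain ⟨⟨hn, hc⟩, -⟩ := h
  rw [List.isChain_append] at hc
  refine ⟨⟨?_, ?_⟩, ?_⟩
  · rw [List.nodup_append] at hn
    simp only [List.nodup_cons, List.nodup_append]
    simpa using ⟨by simpa using hu, hn⟩
  · rw [List.isChain_cons, List.isChain_append]
    refine ⟨?_, isChain_adj_reverse.2 hc.1, hc.2.1, by simpa using h1⟩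
    intro y hy
    apply h2
    cases h : a.getLast? <;> simp_all
  · intro x hx y hy
    have : u = y := by simpa using hy
    subst this
    refine (h3 x ?_).symm
    rcases b.eq_nil_or_concat with rfl | ⟨b', z, rfl⟩
    · exact absurd rfl hb
    · rw [← List.cons_append, List.getLast?_append] at hx
      simpa using hx

lemma IsCycleList.insert_consecutive {l : List W} {u : W} (h : IsCycleList H l)
    (hu : u ∉ l) (hl : l ≠ [])
    (h2 : ∀ x ∈ l.getLast?, H.Adj u x) (h3 : ∀ x ∈ l.head?, H.Adj u x) :
    IsCycleList H (u :: l) := by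
  obtain ⟨⟨hn, hc⟩, -⟩ := h
  refine ⟨⟨List.nodup_cons.2 ⟨hu, hn⟩, List.isChain_cons.2 ⟨h3, hc⟩⟩, ?_⟩
  intro x hx y hy
  have : u = y := by simpa using hy
  subst this
  refine (h2 x ?_).symm
  rcases l.eq_nil_or_concat with rfl | ⟨b', z, rfl⟩
  · exact absurd rfl hl
  · rw [List.concat_eq_append, ← List.cons_append, List.getLast?_append] at hx
    simpa using hx

lemma formPerm_append_cons_cons [DecidableEq W] {a b : List W} {x y : W}
    (h : (a ++ x :: y :: b).Nodup) : (a ++ x :: y :: b).formPerm x = y := by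
  have := List.formPerm_apply_lt_getElem _ h a.length (by simp)
  simpa using this

lemma formPerm_concat_cons [DecidableEq W] {b : List W} {x y : W} :
    (y :: (b ++ [x])).formPerm x = y := List.formPerm_cons_concat_apply_last _ _ _

/-- Large sets of vertices attached to the two ends of a list cross somewhere. -/
lemma exists_crossing [DecidableEq W] {l : List W} {x y : W} (hl : l.Nodup) {X Y : Finset W}
    (hx : x ∈ l.head?) (hy : y ∈ l.getLast?) (hX : X ⊆ l.toFinset.erase x)
    (hY : Y ⊆ l.toFinset.erase y) (hc : l.length ≤ X.card + Y.card) :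
    ∃ a b w z, l = a ++ w :: z :: b ∧ z ∈ X ∧ w ∈ Y := by
  have hxl : x ∈ l := List.mem_of_mem_head? hx
  have hcard : (l.toFinset.erase x).card = l.length - 1 := by
    rw [Finset.card_erase_of_mem (by simpa using hxl), List.toFinset_card_of_nodup hl]
  have hpos := List.length_pos_of_mem hxl
  have key : ∀ w ∈ Y, ∃ a b, l = a ++ w :: l.formPerm w :: b := by
    intro w hw
    have hw' := hY hw
    simp only [Finset.mem_erase, List.mem_toFinset] at hw'
    obtain ⟨a, b, rfl⟩ := List.append_of_mem hw'.2
    cases b with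
    | nil => simp at hy; exact absurd hy hw'.1
    | cons z b => exact ⟨a, b, by rw [formPerm_append_cons_cons hl]⟩
  have hYX : Y.image l.formPerm ⊆ l.toFinset.erase x := by
    intro z hz
    obtain ⟨w, hw, rfl⟩ := Finset.mem_image.1 hz
    obtain ⟨a, b, hab⟩ := key w hw
    rw [Finset.mem_erase, List.mem_toFinset]
    constructor
    · intro h
      rw [h] at hab
      subst hab
      cases a with
      | nil => simp at hx; subst hx; simp at hl
      | cons c a => simp at hx; subst hx; simp at hl
    · rw [List.formPerm_mem_iff_mem]; rw [hab]; simp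
  have hY' : (Y.image l.formPerm).card = Y.card :=
    Finset.card_image_of_injective _ (Equiv.injective _)
  have : ¬ Disjoint X (Y.image l.formPerm) := by
    intro hd
    have h1 := Finset.card_union_of_disjoint hd
    have h2 := Finset.card_le_card (Finset.union_subset hX hYX)
    omega
  obtain ⟨z, hz1, hz2⟩ := Finset.not_disjoint_iff.1 this
  obtain ⟨w, hw, rfl⟩ := Finset.mem_image.1 hz2
  obtain ⟨a, b, hab⟩ := key w hw
  exact ⟨a, b, w, _, hab, hz1, hw⟩

/-- Chvátal–Erdős argument: the successors on a longest cycle of the neighbours of a vertex off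
the cycle are independent, together with that vertex. -/
lemma IsCycleList.indep_succ [Fintype W] [DecidableEq W] {l : List W} {u : W}
    (h : IsCycleList H l) (hu : u ∉ l) (hN : H.neighborFinset u ⊆ l.toFinset)
    (hmax : ∀ l', IsCycleList H l' → l'.length ≠ l.length + 1) :
    ∀ x ∈ insert u ((H.neighborFinset u).image l.formPerm),
      ∀ y ∈ insert u ((H.neighborFinset u).image l.formPerm), ¬ H.Adj x y := by
  have split : ∀ x ∈ H.neighborFinset u, ∃ t : List W, IsCycleList H (t ++ [x]) ∧
      l ~r (t ++ [x]) := by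
    intro x hx
    have hxl := hN hx
    rw [List.mem_toFinset] at hxl
    obtain ⟨a, b, rfl⟩ := List.append_of_mem hxl
    refine ⟨b ++ a, ?_, ?_⟩
    · rw [List.append_assoc]
      apply IsCycleList.append_comm
      simpa using h
    · have : a ++ x :: b = (a ++ [x]) ++ b := by simp
      rw [this, List.append_assoc b]
      exact List.isRotated_append
  have huu : ∀ x ∈ H.neighborFinset u, ¬ H.Adj u (l.formPerm x) := by
    intro x hx hadj
    obtain ⟨t, ht, hr⟩ := split x hx
    rw [List.formPerm_eq_of_isRotated h.1.1 hr] at hadj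
    refine hmax _ (ht.insert_consecutive (u := u) ?_ (by simp) ?_ ?_) ?_
    · rwa [← hr.mem_iff]
    · simpa using hx
    · cases t with
      | nil => simpa using hx
      | cons y t => rw [List.cons_append, formPerm_concat_cons] at hadj; simpa using hadj
    · simp [hr.perm.length_eq]
  have hss : ∀ x ∈ H.neighborFinset u, ∀ y ∈ H.neighborFinset u,
      ¬ H.Adj (l.formPerm x) (l.formPerm y) := by
    intro x hx y hy hadj
    have hxy : y ≠ x := by rintro rfl; exact H.loopless.irrefl _ hadj
    obtain ⟨t, ht, hr⟩ := split x hx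
    have hyt : y ∈ t := by
      have := hN hy
      rw [List.mem_toFinset, hr.mem_iff] at this
      simpa [hxy] using this
    obtain ⟨a, b, rfl⟩ := List.append_of_mem hyt
    have e : a ++ y :: b ++ [x] = (a ++ [y]) ++ (b ++ [x]) := by simp
    rw [List.formPerm_eq_of_isRotated h.1.1 hr] at hadj
    have hnd := ht.1.1
    rw [e] at ht hr
    refine hmax _ (ht.insert_crossing (u := u) ?_ (by simp) (by simp) ?_ ?_ ?_) ?_
    · rwa [← hr.mem_iff]
    · intro p hp q hq
      have hp' : (a ++ y :: b ++ [x]).formPerm x = p := by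
        cases a with
        | nil => simp at hp; subst hp; exact formPerm_concat_cons
        | cons c a => simp at hp; subst hp; exact formPerm_concat_cons
      have hq' : (a ++ y :: b ++ [x]).formPerm y = q := by
        cases b with
        | nil =>
          simp at hq; subst hq
          have := formPerm_append_cons_cons (a := a) (b := []) (x := y) (y := x) (by simpa using hnd)
          simpa using this
        | cons c b =>
          simp at hq; subst hq
          have := formPerm_append_cons_cons (a := a) (b := b ++ [x]) (x := y) (y := c)
            (by simpa using hnd)
          simpa using this
      rwa [hp', hq'] at hadj
    · simpa using hy
    · simpa using hx
    · simp [hr.perm.length_eq]; omega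
  intro x hx y hy
  rw [Finset.mem_insert, Finset.mem_image] at hx hy
  rcases hx with rfl | ⟨x, hx, rfl⟩ <;> rcases hy with rfl | ⟨y, hy, rfl⟩
  · exact H.loopless.irrefl _
  · exact huu y hy
  · exact fun h => huu x hx h.symm
  · exact hss x hx y hy

lemma IsPathList.neighbors_subset [Fintype W] [DecidableEq W] {l : List W} (h : IsPathList H l)
    (hmax : ∀ l', IsPathList H l' → l'.length ≤ l.length) {y : W} (hy : y ∈ l.getLast?) :
    H.neighborFinset y ⊆ l.toFinset.erase y := by
  intro z hz
  rw [mem_neighborFinset] at hz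
  rw [Finset.mem_erase, List.mem_toFinset]
  refine ⟨hz.ne', by_contra fun hzl => ?_⟩
  have : IsPathList H (l ++ [z]) := by
    refine ⟨?_, ?_⟩
    · rw [List.nodup_append]
      refine ⟨h.1, by simp, ?_⟩
      rintro a ha b hb rfl
      simp at hb; subst hb; exact hzl ha
    · rw [List.isChain_append]
      refine ⟨h.2, by simp, ?_⟩
      intro a ha b hb
      rw [Option.mem_unique ha hy]
      simp at hb; subst hb; exact hz
  have := hmax _ this
  simp at this

/-- A cycle through some but not all vertices extends to a longer path. -/
lemma IsCycleList.exists_longer_path [Fintype W] [DecidableEq W] {l : List W}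
    (h : IsCycleList H l) (hl : l ≠ []) (hlt : l.length < Fintype.card W)
    (hdeg : ∀ x, Fintype.card W ≤ 2 * H.degree x + 1) :
    ∃ l', IsPathList H l' ∧ l'.length = l.length + 1 := by
  obtain ⟨q, hq, z, hz, hadj⟩ : ∃ q ∈ l, ∃ z, z ∉ l ∧ H.Adj q z := by
    by_contra! hcon
    obtain ⟨z, hz⟩ : ∃ z, z ∉ l := by
      by_contra! hall
      have : Finset.univ ⊆ l.toFinset := fun x _ => by simpa using hall x
      have := (Finset.card_le_card this).trans (List.toFinset_card_le l)
      rw [Finset.card_univ] at this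
      omega
    obtain ⟨x, hx⟩ := List.exists_mem_of_ne_nil l hl
    have h1 : H.neighborFinset x ⊆ l.toFinset.erase x := by
      intro y hy
      rw [mem_neighborFinset] at hy
      rw [Finset.mem_erase, List.mem_toFinset]
      exact ⟨hy.ne', by_contra fun h => hcon x hx y h hy⟩
    have h2 : H.neighborFinset z ⊆ (l.toFinsetᶜ).erase z := by
      intro y hy
      rw [mem_neighborFinset] at hy
      rw [Finset.mem_erase, Finset.mem_compl, List.mem_toFinset]
      exact ⟨hy.ne', fun h => hcon y h z hz hy.symm⟩
    have h1 := Finset.card_le_card h1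
    have h2 := Finset.card_le_card h2
    rw [Finset.card_erase_of_mem (by simpa using hx), card_neighborFinset_eq_degree,
      List.toFinset_card_of_nodup h.1.1] at h1
    rw [Finset.card_erase_of_mem (by simpa using hz), card_neighborFinset_eq_degree,
      Finset.card_compl, List.toFinset_card_of_nodup h.1.1] at h2
    have := hdeg x
    have := hdeg z
    have := List.length_pos_of_mem hx
    omega
  obtain ⟨a, b, rfl⟩ := List.append_of_mem hq
  have h' : IsCycleList H (b ++ (a ++ [q])) := by
    apply IsCycleList.append_comm; simpa using h
  refine ⟨b ++ (a ++ [q]) ++ [z], ⟨?_, ?_⟩, by simp; omega⟩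
  · rw [List.nodup_append]
    refine ⟨h'.1.1, by simp, ?_⟩
    rintro c hc d hd rfl
    simp at hd; subst hd
    apply hz
    simp at hc ⊢; tauto
  · rw [List.isChain_append]
    refine ⟨h'.1.2, by simp, ?_⟩
    rw [← List.append_assoc]
    simpa using hadj

lemma IsPathList.close_crossing {a b : List W} {x y w z : W} (hl : IsPathList H (a ++ w :: z :: b))
    (hx : x ∈ (a ++ w :: z :: b).head?) (hy : y ∈ (a ++ w :: z :: b).getLast?)
    (hz : H.Adj x z) (hw : H.Adj w y) : IsCycleList H ((a ++ [w]).reverse ++ z :: b) := by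
  have e : a ++ w :: z :: b = (a ++ [w]) ++ (z :: b) := by simp
  rw [e] at hl hx hy
  refine hl.isCycleList_reverse_append (by simp)
    (by
      intro p hp q hq
      rw [List.head?_append_of_ne_nil _ (by simp)] at hx
      rw [Option.mem_unique hp hx]
      simp at hq; subst hq; exact hz)
    (by
      intro p hp q hq
      rw [List.getLast?_append_of_ne_nil _ (by simp)] at hy
      rw [Option.mem_unique hq hy]
      simp at hp; subst hp; exact hw) (by simp)

lemma exists_hamiltonian_path [Fintype W] [DecidableEq W] (hW : 2 ≤ Fintype.card W)
    (hdeg : ∀ x, Fintype.card W ≤ 2 * H.degree x + 1) :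
    ∃ l, IsPathList H l ∧ l.length = Fintype.card W := by
  have hbd : ∀ l, IsPathList H l → l.length ≤ Fintype.card W := fun l h => h.1.length_le_card
  obtain ⟨l, hl, hmax⟩ : ∃ l, IsPathList H l ∧ ∀ l', IsPathList H l' → l'.length ≤ l.length := by
    obtain ⟨l, h1, h2⟩ := Nat.findGreatest_spec (P := fun k => ∃ l, IsPathList H l ∧ l.length = k)
      (Nat.zero_le (Fintype.card W)) ⟨[], ⟨by simp, by simp⟩, rfl⟩
    exact ⟨l, h1, fun l' h' => h2 ▸ Nat.le_findGreatest (hbd l' h') ⟨l', h', rfl⟩⟩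
  refine ⟨l, hl, le_antisymm (hbd l hl) (not_lt.1 fun hlt => ?_)⟩
  obtain ⟨v⟩ : Nonempty W := Fintype.card_pos_iff.1 (by omega)
  have hne : l ≠ [] := by
    rintro rfl
    have := hmax [v] ⟨by simp, by simp⟩
    simp at this
  obtain ⟨x, hx⟩ : ∃ x, x ∈ l.head? := ⟨_, List.head_mem_head? hne⟩
  obtain ⟨y, hy⟩ : ∃ y, y ∈ l.getLast? := ⟨_, List.getLast_mem_getLast? hne⟩
  have hX : H.neighborFinset x ⊆ l.toFinset.erase x := by
    have := hl.reverse.neighbors_subset (y := x) (by simpa using hmax) (by simpa using hx)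
    simpa using this
  obtain ⟨a, b, w, z, rfl, hz, hw⟩ := exists_crossing hl.1 hx hy hX (hl.neighbors_subset hmax hy)
    (by
      rw [card_neighborFinset_eq_degree, card_neighborFinset_eq_degree]
      have := hdeg x
      have := hdeg y
      omega)
  rw [mem_neighborFinset] at hz hw
  have hcyc := hl.close_crossing hx hy hz hw.symm
  obtain ⟨l', h1, h2⟩ := hcyc.exists_longer_path (by simp) (by simp at hlt ⊢; omega) hdeg
  have := hmax l' h1
  simp at this h2
  omega

lemma IsPathList.isCycleList_reverse_append_reverse {P M Q : List W}
    (h : IsPathList H (P ++ (M ++ Q))) (hP : P ≠ []) (hM : M ≠ []) (hQ : Q ≠ [])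
    (h1 : ∀ x ∈ P.head?, ∀ y ∈ M.head?, H.Adj x y)
    (h2 : ∀ x ∈ M.getLast?, ∀ y ∈ Q.getLast?, H.Adj x y)
    (h3 : ∀ x ∈ P.getLast?, ∀ y ∈ Q.head?, H.Adj x y) :
    IsCycleList H (P.reverse ++ (M ++ Q.reverse)) := by
  obtain ⟨hn, hc⟩ := h
  refine ⟨⟨?_, ?_⟩, ?_⟩
  · refine (List.Perm.nodup_iff ?_).2 hn
    exact (List.reverse_perm P).append ((List.Perm.refl M).append (List.reverse_perm Q))
  · rw [List.isChain_append, List.isChain_append] at hc ⊢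
    refine ⟨isChain_adj_reverse.2 hc.1, ⟨hc.2.1.1, isChain_adj_reverse.2 hc.2.1.2.1, ?_⟩, ?_⟩
    · simpa using h2
    · rw [List.head?_append_of_ne_nil _ hM]
      simpa using h1
  · rw [List.head?_append_of_ne_nil _ (by simpa), List.getLast?_append_of_ne_nil _ (by simp [hQ]),
      List.getLast?_append_of_ne_nil _ (by simpa)]
    simp only [List.getLast?_reverse, List.head?_reverse]
    exact fun x hx y hy => (h3 y hy x hx).symm

lemma exists_append_of_isChain_imp {P : W → Prop} {t : List W}
    (h : t.IsChain fun u z => P z → P u) :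
    ∃ t₁ t₂, t = t₁ ++ t₂ ∧ (∀ e ∈ t₁, P e) ∧ ∀ f ∈ t₂, ¬ P f := by
  induction t with
  | nil => exact ⟨[], [], by simp⟩
  | cons c t ih =>
    obtain ⟨t₁, t₂, rfl, h1, h2⟩ := ih h.tail
    by_cases hc : P c
    · exact ⟨c :: t₁, t₂, by simp, by simpa using ⟨hc, h1⟩, h2⟩
    · cases t₁ with
      | nil => exact ⟨[], c :: t₂, by simp, by simp, by simpa using ⟨hc, h2⟩⟩
      | cons d t₁ =>
        refine absurd ?_ hc
        rw [List.cons_append, List.isChain_cons_cons] at h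
        exact h.1 (h1 d (by simp))

/-- A graph on `m ≥ 3` vertices with minimum degree at least `(m - 1) / 2` is Hamiltonian, unless
`m` is odd and the graph has a large independent set or a cut vertex. -/
theorem exists_hamiltonian_cycleList [Fintype W] [DecidableEq W] (hW : 3 ≤ Fintype.card W)
    (hdeg : ∀ x, Fintype.card W ≤ 2 * H.degree x + 1) :
    (∃ l, IsCycleList H l ∧ l.length = Fintype.card W) ∨ (Odd (Fintype.card W) ∧
      ((∃ S : Finset W, Fintype.card W + 1 ≤ 2 * S.card ∧ ∀ x ∈ S, ∀ y ∈ S, ¬ H.Adj x y) ∨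
      ∃ (q : W) (A B : Finset W), A.Nonempty ∧ B.Nonempty ∧ (∀ z, z = q ∨ z ∈ A ∨ z ∈ B) ∧
        q ∉ A ∧ q ∉ B ∧ Disjoint A B ∧ ∀ x ∈ A, ∀ y ∈ B, ¬ H.Adj x y)) := by
  refine or_iff_not_imp_left.2 fun hno => ?_
  replace hno : ∀ l, IsCycleList H l → l.length ≠ Fintype.card W :=
    fun l h1 h2 => hno ⟨l, h1, h2⟩
  obtain ⟨l, hl, hlen⟩ := exists_hamiltonian_path (by omega) hdeg
  have hmem : ∀ v, v ∈ l := by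
    intro v
    have : l.toFinset = Finset.univ := by
      rw [← Finset.card_eq_iff_eq_univ, List.toFinset_card_of_nodup hl.1, hlen]
    rw [← List.mem_toFinset, this]
    exact Finset.mem_univ v
  have hne : l ≠ [] := by
    rintro rfl
    simp at hlen
    omega
  obtain ⟨y, hy⟩ : ∃ y, y ∈ l.getLast? := ⟨_, List.getLast_mem_getLast? hne⟩
  obtain ⟨x, t, rfl⟩ : ∃ x t, l = x :: t := List.exists_cons_of_ne_nil hne
  have hx : x ∈ (x :: t).head? := by simp
  have hN : ∀ v, H.neighborFinset v ⊆ (x :: t).toFinset.erase v := by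
    intro v z hz
    rw [mem_neighborFinset] at hz
    rw [Finset.mem_erase, List.mem_toFinset]
    exact ⟨hz.ne', hmem z⟩
  have hnot : ∀ a b w z, x :: t = a ++ w :: z :: b → H.Adj x z → ¬ H.Adj w y := by
    intro a b w z h hz hw
    rw [h] at hl hx hy hlen
    exact hno _ (hl.close_crossing hx hy hz hw) (by rw [← hlen]; simp; omega)
  have hsum : (H.neighborFinset x).card + (H.neighborFinset y).card < (x :: t).length := by
    by_contra! hle
    obtain ⟨a, b, w, z, h, hz, hw⟩ := exists_crossing hl.1 hx hy (hN x) (hN y) hle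
    rw [mem_neighborFinset] at hz hw
    exact hnot a b w z h hz hw.symm
  rw [hlen, card_neighborFinset_eq_degree, card_neighborFinset_eq_degree] at hsum
  have hdx := hdeg x
  have hdy := hdeg y
  refine ⟨⟨H.degree x, by omega⟩, ?_⟩
  have hone : ∀ a b w z, x :: t = a ++ w :: z :: b → ¬ H.Adj x z → H.Adj w y := by
    intro a b w z h hz
    have hnd := hl.1
    have hzx : z ≠ x := by
      rintro rfl
      cases a with
      | nil => simp at h; rw [h.2, h.1] at hnd; simp at hnd
      | cons c a => simp at h; rw [h.2] at hnd; simp at hnd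
    obtain ⟨a', b', w', z', h', hz', hw'⟩ := exists_crossing (X := insert z (H.neighborFinset x))
      hl.1 hx hy (by
        refine Finset.insert_subset ?_ (hN x)
        rw [Finset.mem_erase, List.mem_toFinset]
        exact ⟨hzx, hmem z⟩) (hN y) (by
        rw [Finset.card_insert_of_notMem (by simpa using hz), card_neighborFinset_eq_degree,
          card_neighborFinset_eq_degree, hlen]
        omega)
    rw [mem_neighborFinset] at hw'
    rw [Finset.mem_insert, mem_neighborFinset] at hz'
    rcases hz' with rfl | hz'
    · have e1 : (x :: t).formPerm w = z' := by
        rw [h] at hnd ⊢; exact formPerm_append_cons_cons hnd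
      have e2 : (x :: t).formPerm w' = z' := by
        rw [h'] at hnd ⊢; exact formPerm_append_cons_cons hnd
      rw [← e2] at e1
      rw [Equiv.injective _ e1]
      exact hw'.symm
    · exact absurd hw'.symm (hnot a' b' w' z' h' hz')
  by_cases hgap : ∃ a b w u z, x :: t = a ++ w :: u :: z :: b ∧ ¬ H.Adj x u ∧ H.Adj x z
  · left
    obtain ⟨a, b, w, u, z, h, hu, hz⟩ := hgap
    have hwy := hone a (z :: b) w u h hu
    rw [h] at hl hx hy hlen hmem
    have hnd := hl.1
    have hch := hl.2
    have e : a ++ w :: u :: z :: b = (a ++ [w]) ++ ([u] ++ (z :: b)) := by simp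
    have hmid : (a ++ w :: u :: z :: b).Perm (u :: ((a ++ [w]) ++ (z :: b))) := by
      rw [e]; exact List.perm_middle
    have hcyc : IsCycleList H ((a ++ [w]) ++ (z :: b).reverse) := by
      refine ⟨⟨?_, ?_⟩, ?_⟩
      · rw [(((List.Perm.refl (a ++ [w])).append (List.reverse_perm (z :: b)))).nodup_iff]
        exact (List.nodup_cons.1 (hmid.nodup_iff.1 hnd)).2
      · rw [e] at hch
        rw [List.isChain_append]
        refine ⟨hch.left_of_append,
          isChain_adj_reverse.2 hch.right_of_append.right_of_append, ?_⟩
        intro p hp q hq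
        rw [e, List.getLast?_append_of_ne_nil _ (by simp),
          List.getLast?_append_of_ne_nil _ (by simp)] at hy
        rw [List.head?_reverse] at hq
        rw [Option.mem_unique hq hy]
        simp at hp; subst hp; exact hwy
      · intro p hp q hq
        rw [List.head?_append_of_ne_nil _ (by simp)] at hq
        rw [e, List.head?_append_of_ne_nil _ (by simp)] at hx
        rw [Option.mem_unique hq hx]
        rw [List.getLast?_append_of_ne_nil _ (by simp), List.getLast?_reverse] at hp
        simp at hp; subst hp; exact hz.symm
    have hmem' : ∀ v, v ≠ u → v ∈ (a ++ [w]) ++ (z :: b).reverse := by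
      intro v hv
      have := hmem v
      simp at this ⊢
      tauto
    have hu' : u ∉ (a ++ [w]) ++ (z :: b).reverse := by
      have := (List.nodup_cons.1 (hmid.nodup_iff.1 hnd)).1
      simp at this ⊢
      tauto
    have hNu : H.neighborFinset u ⊆ ((a ++ [w]) ++ (z :: b).reverse).toFinset := by
      intro v hv
      rw [mem_neighborFinset] at hv
      rw [List.mem_toFinset]
      exact hmem' v hv.ne'
    refine ⟨_, ?_, hcyc.indep_succ hu' hNu fun l' h' hl' => hno l' h' ?_⟩
    · rw [Finset.card_insert_of_notMem, Finset.card_image_of_injective _ (Equiv.injective _),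
        card_neighborFinset_eq_degree]
      · have := hdeg u
        omega
      · intro hmem
        obtain ⟨v, hv, hvu⟩ := Finset.mem_image.1 hmem
        have := hNu hv
        rw [List.mem_toFinset, ← List.formPerm_mem_iff_mem, hvu] at this
        exact hu' this
    · rw [hl', ← hlen]; simp; omega
  · right
    have hchain : t.IsChain fun u z => H.Adj x z → H.Adj x u := by
      rw [List.isChain_iff_forall_rel_of_append_cons_cons]
      intro u z a b h hz
      by_contra hu
      rcases List.eq_nil_or_concat' (x :: a) with h0 | ⟨a', w, h0⟩
      · simp at h0
      · refine hgap ⟨a', b, w, u, z, ?_, hu, hz⟩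
        rw [h, ← List.cons_append, h0]
        simp
    obtain ⟨t₁, t₂, rfl, ht₁, ht₂⟩ := exists_append_of_isChain_imp hchain
    have hne₂ : t₂ ≠ [] := by
      rintro rfl
      refine hno _ ⟨hl, fun p hp q hq => ?_⟩ hlen
      rw [Option.mem_unique hp hy, Option.mem_unique hq hx]
      refine (ht₁ y ?_).symm
      have : t₁ ≠ [] := by rintro rfl; simp at hlen; omega
      rw [List.append_nil, ← List.singleton_append, List.getLast?_append_of_ne_nil _ this] at hy
      exact List.mem_of_getLast? hy
    rcases List.eq_nil_or_concat' t₁ with rfl | ⟨t₁, q, rfl⟩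
    · obtain ⟨c, t₂, rfl⟩ := List.exists_cons_of_ne_nil hne₂
      have := hl.2
      rw [List.nil_append, List.isChain_cons_cons] at this
      exact absurd this.1 (ht₂ c (by simp))
    have hnd := hl.1
    refine ⟨q, (x :: t₁).toFinset, t₂.toFinset, ⟨x, by simp⟩, ?_, ?_, ?_, ?_, ?_, ?_⟩
    · simpa using hne₂
    · intro z
      have := hmem z
      simp at this ⊢
      tauto
    · rw [← List.cons_append, List.nodup_append, ← List.cons_append, List.nodup_append] at hnd
      rw [List.mem_toFinset]
      exact fun hq => hnd.1.2.2 q hq q (by simp) rfl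
    · rw [← List.cons_append, List.nodup_append] at hnd
      rw [List.mem_toFinset]
      exact fun hq => hnd.2.2 q (by simp) q hq rfl
    · rw [← List.cons_append, List.nodup_append] at hnd
      rw [Finset.disjoint_left]
      intro c hc hc'
      rw [List.mem_toFinset] at hc hc'
      exact hnd.2.2 c (by simp at hc ⊢; tauto) c hc' rfl
    · intro e he f hf hef
      rw [List.mem_toFinset] at he hf
      have hxf := ht₂ f hf
      obtain ⟨s, s', hs⟩ := List.append_of_mem he
      obtain ⟨c, d, rfl⟩ := List.append_of_mem hf
      have hs' : ∀ p ∈ s', p ∈ t₁ := by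
        intro p hp
        cases s with
        | nil => simp at hs; rw [hs.2]; exact hp
        | cons _ s => simp at hs; rw [hs.2]; simp [hp]
      obtain ⟨c', g, hg⟩ : ∃ c' g, q :: c = c' ++ [g] := by
        rcases List.eq_nil_or_concat' (q :: c) with h0 | ⟨c', g, h0⟩
        · simp at h0
        · exact ⟨c', g, h0⟩
      have e1 : x :: (t₁ ++ [q] ++ (c ++ f :: d)) = (x :: t₁) ++ (q :: c) ++ f :: d := by simp
      have hgy : H.Adj g y := by
        refine hone (x :: t₁ ++ c') d g f ?_ hxf
        rw [e1, hg]; simp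
      have e2 : x :: (t₁ ++ [q] ++ (c ++ f :: d)) =
          (s ++ [e]) ++ ((s' ++ (q :: c)) ++ (f :: d)) := by rw [e1, hs]; simp
      have hxs : x ∈ (s ++ [e]).head? := by
        cases s with
        | nil => simp at hs; simp [hs.1]
        | cons _ s => simp at hs; simp [hs.1]
      rw [e2] at hl hy hlen
      refine hno _ (hl.isCycleList_reverse_append_reverse (by simp) (by simp) (by simp)
        ?_ ?_ ?_) ?_
      · intro p hp r hr
        rw [Option.mem_unique hp hxs]
        apply ht₁
        cases s' with
        | nil => simp at hr; simp [hr]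
        | cons r' s' =>
          simp at hr; subst hr
          have := hs' r' (by simp)
          simp [this]
      · intro p hp r hr
        rw [← List.append_assoc, List.getLast?_append_of_ne_nil _ (by simp)] at hy
        rw [Option.mem_unique hr hy]
        rw [hg, ← List.append_assoc, List.getLast?_concat] at hp
        simp at hp; subst hp; exact hgy
      · intro p hp r hr
        simp at hp hr
        subst hp hr
        exact hef
      · rw [← hlen]; simp; omega

lemma IsCycleList.map_val {p : W → Prop} {l : List {x // p x}}
    (h : IsCycleList (H.comap Subtype.val) l) : IsCycleList H (l.map Subtype.val) := by
  obtain ⟨⟨h1, h2⟩, h3⟩ := h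
  refine ⟨⟨h1.map Subtype.val_injective, ?_⟩, ?_⟩
  · rw [List.isChain_map]
    exact h2
  · intro x hx y hy
    simp only [List.getLast?_map, List.head?_map, Option.mem_map] at hx hy
    obtain ⟨x, hx, rfl⟩ := hx
    obtain ⟨y, hy, rfl⟩ := hy
    exact h3 x hx y hy

lemma IsCycleList.exists_isCycle {l : List W} (h : IsCycleList H l) (hl : 3 ≤ l.length) :
    ∃ (v : W) (c : H.Walk v v), c.IsCycle ∧ ∀ x, x ∈ c.support ↔ x ∈ l := by
  obtain ⟨⟨hn, hc⟩, hlast⟩ := h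
  rcases List.eq_nil_or_concat' l with rfl | ⟨t, a, rfl⟩
  · simp at hl
  have hch : (a :: (t ++ [a])).IsChain H.Adj := by
    rw [List.isChain_cons]
    exact ⟨fun y hy => hlast a (by simp) y hy, hc⟩
  have hne : a :: (t ++ [a]) ≠ [] := List.cons_ne_nil _ _
  obtain ⟨c, hsupp⟩ : ∃ c : H.Walk a a, c.support = a :: (t ++ [a]) :=
    have hend : (a :: (t ++ [a])).getLast hne = a := by simp
    ⟨(Walk.ofSupport _ hne hch).copy rfl hend,
      (Walk.support_copy _ rfl hend).trans (Walk.support_ofSupport hne hch)⟩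
  have hlen : c.length = t.length + 1 := by
    have := c.length_support
    rw [hsupp] at this
    simpa using this.symm
  refine ⟨a, c, ?_, by intro x; rw [hsupp]; simp; tauto⟩
  rw [Walk.isCycle_iff_isPath_tail_and_le_length]
  have hnil : ¬ c.Nil := by
    rw [← Walk.length_eq_zero_iff]
    omega
  refine ⟨?_, by simp at hl; omega⟩
  rw [Walk.isPath_def, Walk.support_tail_of_not_nil _ hnil, hsupp]
  exact hn

lemma isHamiltonianCycle_of_forall_mem_support [DecidableEq W] {v : W} {c : H.Walk v v}
    (hc : c.IsCycle) (h : ∀ x, x ∈ c.support) : c.IsHamiltonianCycle := by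
  rw [Walk.isHamiltonianCycle_iff_isCycle_and_support_count_tail_eq_one]
  refine ⟨hc, fun a => List.count_eq_one_of_mem hc.support_nodup ?_⟩
  rcases Walk.mem_support_iff c |>.1 (h a) with rfl | ha
  · exact Walk.end_mem_tail_support hc.not_nil
  · exact ha

/-- A closed walk through an independent set spends at least every other step outside it. -/
lemma two_mul_card_le_length [DecidableEq W] {v : W} {c : H.Walk v v} (hc : c.IsCycle) {S : Finset W}
    (hS : ∀ x ∈ S, ∀ y ∈ S, ¬ H.Adj x y) (hsub : ∀ x ∈ S, x ∈ c.support) :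
    2 * S.card ≤ c.length := by
  have h1 : S.card ≤ c.darts.countP fun d => d.fst ∈ S := by
    have : S ⊆ ((c.darts.filter fun d => d.fst ∈ S).map fun d => d.fst).toFinset := by
      intro s hs
      rw [List.mem_toFinset, List.mem_map]
      have := hsub s hs
      rw [← Walk.map_fst_darts_append, List.mem_append, List.mem_map] at this
      rcases this with ⟨d, hd, rfl⟩ | hsv
      · exact ⟨d, by simpa using ⟨hd, hs⟩, rfl⟩
      · simp at hsv
        subst hsv
        cases c with
        | nil => exact absurd Walk.Nil.nil hc.not_nil
        | cons h p => exact ⟨⟨(s, _), h⟩, by simpa using hs, rfl⟩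
    have := (Finset.card_le_card this).trans (List.toFinset_card_le _)
    rwa [List.length_map, ← List.countP_eq_length_filter] at this
  have h2 : S.card ≤ c.darts.countP fun d => d.snd ∈ S := by
    have : S ⊆ ((c.darts.filter fun d => d.snd ∈ S).map fun d => d.snd).toFinset := by
      intro s hs
      rw [List.mem_toFinset, List.mem_map]
      have hs' : s ∈ c.support.tail := by
        rcases Walk.mem_support_iff c |>.1 (hsub s hs) with rfl | ha
        · exact Walk.end_mem_tail_support hc.not_nil
        · exact ha
      rw [← Walk.map_snd_darts, List.mem_map] at hs'
      obtain ⟨d, hd, rfl⟩ := hs'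
      exact ⟨d, by simpa using ⟨hd, hs⟩, rfl⟩
    have := (Finset.card_le_card this).trans (List.toFinset_card_le _)
    rwa [List.length_map, ← List.countP_eq_length_filter] at this
  have h3 : (c.darts.countP fun d => d.snd ∈ S) ≤ c.darts.countP fun d => ¬ d.fst ∈ S := by
    refine List.countP_mono_left fun d _ hd => ?_
    simp only [decide_eq_true_eq] at hd ⊢
    exact fun hf => hS _ hf _ hd d.adj
  have h4 := List.length_eq_countP_add_countP (fun d : H.Dart => decide (d.fst ∈ S)) (l := c.darts)
  simp only [decide_eq_true_eq, Walk.length_darts] at h4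
  simp only [decide_not] at h3 h4
  omega

end CycleLists

section HForce

variable {V : Type*} [Fintype V] [DecidableEq V] {G Gw : SimpleGraph V}

lemma exists_isCycle_avoiding (R : Finset V) (hR : 3 + R.card ≤ Fintype.card V)
    (hdeg : ∀ x, x ∉ R → Fintype.card V ≤ R.card + 2 * (G.neighborFinset x \ R).card + 1) :
    (∃ (v : V) (c : G.Walk v v), c.IsCycle ∧ ∀ x, x ∈ c.support ↔ x ∉ R) ∨
    (Odd (Fintype.card V - R.card) ∧
      ((∃ S : Finset V, Fintype.card V - R.card + 1 ≤ 2 * S.card ∧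
        ∀ x ∈ S, ∀ y ∈ S, ¬ G.Adj x y) ∨
      ∃ (q : V) (A B : Finset V), A.Nonempty ∧ B.Nonempty ∧
        (∀ z, z ∈ R ∨ z = q ∨ z ∈ A ∨ z ∈ B) ∧ q ∉ R ∧ Disjoint R A ∧ Disjoint R B ∧
        q ∉ A ∧ q ∉ B ∧ Disjoint A B ∧ ∀ x ∈ A, ∀ y ∈ B, ¬ G.Adj x y)) := by
  have hcard : Fintype.card {x // x ∉ R} = Fintype.card V - R.card := by
    rw [Fintype.card_subtype_compl]; simp
  have key := exists_hamiltonian_cycleList (W := {x // x ∉ R})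
    (H := G.comap Subtype.val) (by omega) (by
      intro x
      have h1 : ((G.comap Subtype.val).neighborFinset x).map (Function.Embedding.subtype _) =
          G.neighborFinset x.1 \ R := by
        ext y
        simp
      have h2 := hdeg x.1 x.2
      rw [← h1, Finset.card_map, card_neighborFinset_eq_degree] at h2
      convert (show Fintype.card V - R.card ≤ 2 * (G.comap Subtype.val).degree x + 1 by omega))
  rw [hcard] at key
  rcases key with ⟨l, hl, hlen⟩ | ⟨hodd, ⟨S, hS, hind⟩ | ⟨q, A, B, hA, hB, hz, hqA, hqB, hd, hAB⟩⟩
  · left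
    obtain ⟨v, c, hc, hsupp⟩ := hl.map_val.exists_isCycle (by rw [List.length_map]; omega)
    refine ⟨v, c, hc, fun x => ?_⟩
    have huniv : l.toFinset = Finset.univ := by
      rw [← Finset.card_eq_iff_eq_univ, List.toFinset_card_of_nodup hl.1.1, hlen, hcard]
    rw [hsupp, List.mem_map]
    constructor
    · rintro ⟨y, -, rfl⟩
      exact y.2
    · intro hx
      refine ⟨⟨x, hx⟩, ?_, rfl⟩
      rw [← List.mem_toFinset, huniv]
      exact Finset.mem_univ _
  · refine Or.inr ⟨hodd, Or.inl ⟨S.map (Function.Embedding.subtype _), ?_, ?_⟩⟩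
    · rwa [Finset.card_map]
    · intro x hx y hy
      obtain ⟨x, hx', rfl⟩ := Finset.mem_map.1 hx
      obtain ⟨y, hy', rfl⟩ := Finset.mem_map.1 hy
      exact hind x hx' y hy'
  · refine Or.inr ⟨hodd, Or.inr ⟨q.1, A.map (Function.Embedding.subtype _),
      B.map (Function.Embedding.subtype _), hA.map, hB.map, ?_, q.2, ?_, ?_, ?_, ?_, ?_, ?_⟩⟩
    · intro z
      by_cases hzR : z ∈ R
      · exact Or.inl hzR
      · have := hz ⟨z, hzR⟩
        rw [Subtype.ext_iff] at this
        simp only [Finset.mem_map, Function.Embedding.subtype_apply, Subtype.exists,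
          exists_and_right, exists_eq_right]
        tauto
    · rw [Finset.disjoint_right]
      intro x hx
      obtain ⟨x, -, rfl⟩ := Finset.mem_map.1 hx
      exact x.2
    · rw [Finset.disjoint_right]
      intro x hx
      obtain ⟨x, -, rfl⟩ := Finset.mem_map.1 hx
      exact x.2
    · simpa using fun _ => hqA
    · simpa using fun _ => hqB
    · rwa [Finset.disjoint_map]
    · intro x hx y hy
      obtain ⟨x, hx', rfl⟩ := Finset.mem_map.1 hx
      obtain ⟨y, hy', rfl⟩ := Finset.mem_map.1 hy
      exact hAB x hx' y hy'

lemma IsMinHForceSet.hForce_eq {X : Finset V} (h : IsMinHForceSet G X) : hForce G = X.card := by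
  refine le_antisymm (Nat.sInf_le ⟨X, h.1, rfl⟩) ?_
  refine le_csInf ⟨_, X, h.1, rfl⟩ ?_
  rintro k ⟨Y, hY, rfl⟩
  exact h.2 Y hY

/-- An H-force set meets the complement of every non-Hamiltonian cycle. -/
lemma IsHForceSet.exists_mem_of_isCycle {X R : Finset V} (h : IsHForceSet G X)
    (hR : R.Nonempty) (hc : ∃ (v : V) (c : G.Walk v v), c.IsCycle ∧ ∀ x, x ∈ c.support ↔ x ∉ R) :
    ∃ x ∈ X, x ∈ R := by
  by_contra! hcon
  obtain ⟨v, c, hc, hsupp⟩ := hc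
  have := h.2 v c hc fun x hx => (hsupp x).2 (hcon x hx)
  obtain ⟨r, hr⟩ := hR
  exact (hsupp r).1 (this.mem_support r) hr

lemma degree_le_card_sub_of_indep {H : SimpleGraph V} {S : Finset V}
    (hS : ∀ x ∈ S, ∀ y ∈ S, ¬ H.Adj x y) {s : V} (hs : s ∈ S) :
    H.neighborFinset s ⊆ Sᶜ ∧ H.degree s ≤ Fintype.card V - S.card := by
  have h : H.neighborFinset s ⊆ Sᶜ := by
    intro y hy
    rw [mem_neighborFinset] at hy
    rw [Finset.mem_compl]
    exact fun hyS => hS s hs y hyS hy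
  refine ⟨h, ?_⟩
  rw [← card_neighborFinset_eq_degree, ← Finset.card_compl]
  exact Finset.card_le_card h

/-- In a graph of minimum degree at least `n / 2`, an independent set of size at least `n / 2`
is a smallest H-force set. -/
lemma isMinHForceSet_of_indep (hn : 5 ≤ Fintype.card V)
    (hδ : ∀ x, Fintype.card V ≤ 2 * G.degree x) {S : Finset V}
    (hS : ∀ x ∈ S, ∀ y ∈ S, ¬ G.Adj x y) (hcard : Fintype.card V ≤ 2 * S.card) :
    IsMinHForceSet G S ∧ 2 * S.card = Fintype.card V := by
  have hne : S.Nonempty := Finset.card_pos.1 (by omega)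
  have hSV : S.card ≤ Fintype.card V := Finset.card_le_univ S
  have heq : 2 * S.card = Fintype.card V := by
    obtain ⟨s, hs⟩ := hne
    have := (degree_le_card_sub_of_indep hS hs).2
    have := hδ s
    omega
  have hnbr : ∀ s ∈ S, G.neighborFinset s = Sᶜ := by
    intro s hs
    refine Finset.eq_of_subset_of_card_le (degree_le_card_sub_of_indep hS hs).1 ?_
    rw [card_neighborFinset_eq_degree, Finset.card_compl]
    have := hδ s
    omega
  have hadj : ∀ s ∈ S, ∀ t, t ∉ S → G.Adj s t := by
    intro s hs t ht
    rw [← mem_neighborFinset, hnbr s hs, Finset.mem_compl]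
    exact ht
  refine ⟨⟨⟨hne, fun v c hc hsub => ?_⟩, fun Y hY => ?_⟩, heq⟩
  · rw [Walk.isHamiltonianCycle_iff_isCycle_and_length_eq]
    refine ⟨hc, le_antisymm ?_ (heq ▸ two_mul_card_le_length hc hS hsub)⟩
    have := hc.support_nodup.length_le_card
    rwa [List.length_tail, Walk.length_support, Nat.add_sub_cancel] at this
  · have hhit : ∀ s ∈ S, ∀ t, t ∉ S → s ∈ Y ∨ t ∈ Y := by
      intro s hs t ht
      have hst : s ≠ t := by rintro rfl; exact ht hs
      have hR : ({s, t} : Finset V).card = 2 := Finset.card_pair hst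
      have key := exists_isCycle_avoiding (G := G) {s, t} (by omega) (by
        intro x hx
        simp only [Finset.mem_insert, Finset.mem_singleton, not_or] at hx
        rw [hR]
        by_cases hxS : x ∈ S
        · have hsub : Sᶜ.erase t ⊆ G.neighborFinset x \ {s, t} := by
            intro y hy
            rw [hnbr x hxS]
            simp only [Finset.mem_erase, Finset.mem_compl, Finset.mem_sdiff, Finset.mem_insert,
              Finset.mem_singleton, not_or] at hy ⊢
            refine ⟨hy.2, ?_, hy.1⟩
            rintro rfl
            exact hy.2 hs
          have := Finset.card_le_card hsub
          rw [Finset.card_erase_of_mem (by simpa using ht), Finset.card_compl] at this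
          omega
        · have hsub : S.erase s ⊆ G.neighborFinset x \ {s, t} := by
            intro y hy
            simp only [Finset.mem_erase, Finset.mem_sdiff, Finset.mem_insert,
              Finset.mem_singleton, not_or, mem_neighborFinset] at hy ⊢
            refine ⟨(hadj y hy.2 x hxS).symm, hy.1, ?_⟩
            rintro rfl
            exact ht hy.2
          have := Finset.card_le_card hsub
          rw [Finset.card_erase_of_mem hs] at this
          omega)
      rcases key with hc | ⟨hodd, -⟩
      · obtain ⟨x, hx, hxR⟩ := hY.exists_mem_of_isCycle ⟨s, by simp⟩ hc
        simp only [Finset.mem_insert, Finset.mem_singleton] at hxR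
        rcases hxR with rfl | rfl
        · exact Or.inl hx
        · exact Or.inr hx
      · obtain ⟨k, hk⟩ := hodd
        omega
    by_cases hSY : S ⊆ Y
    · exact Finset.card_le_card hSY
    · obtain ⟨s, hs, hsY⟩ := Finset.not_subset.1 hSY
      have : Sᶜ ⊆ Y := fun t ht => (hhit s hs t (by simpa using ht)).resolve_left hsY
      have := Finset.card_le_card this
      rw [Finset.card_compl] at this
      omega

omit [Fintype V] [DecidableEq V] in
lemma forall_mem_or_forall_mem_of_isChain {l : List V} {A B : Finset V} (hl : l.IsChain G.Adj)
    (hAB : ∀ x ∈ A, ∀ y ∈ B, ¬ G.Adj x y) (h : ∀ x ∈ l, x ∈ A ∨ x ∈ B) :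
    (∀ x ∈ l, x ∈ A) ∨ ∀ x ∈ l, x ∈ B := by
  induction l with
  | nil => simp
  | cons a l ih =>
    have ih' := ih hl.tail fun x hx => h x (List.mem_cons_of_mem _ hx)
    cases l with
    | nil => simpa using h a (by simp)
    | cons b l =>
      have hab : G.Adj a b := (List.isChain_cons_cons.1 hl).1
      rcases ih' with ih' | ih'
      · refine Or.inl fun x hx => ?_
        rcases List.mem_cons.1 hx with rfl | hx
        · exact (h x (by simp)).resolve_right fun hb => hAB b (ih' b (by simp)) x hb hab.symm
        · exact ih' x hx
      · refine Or.inr fun x hx => ?_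
        rcases List.mem_cons.1 hx with rfl | hx
        · exact (h x (by simp)).resolve_left fun ha => hAB x ha b (ih' b (by simp)) hab
        · exact ih' x hx

/-- `{p, q}` separates the vertices of `A` from those of `B`. -/
structure IsTwoCut (G : SimpleGraph V) (p q : V) (A B : Finset V) : Prop where
  ne : p ≠ q
  left_nonempty : A.Nonempty
  right_nonempty : B.Nonempty
  cover : ∀ z, z = p ∨ z = q ∨ z ∈ A ∨ z ∈ B
  fst_notMem_left : p ∉ A
  fst_notMem_right : p ∉ B
  snd_notMem_left : q ∉ A
  snd_notMem_right : q ∉ B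
  disj : Disjoint A B
  not_adj : ∀ x ∈ A, ∀ y ∈ B, ¬ G.Adj x y

namespace IsTwoCut

variable {p q : V} {A B : Finset V}

omit [Fintype V] [DecidableEq V] in
lemma swap_sides (h : IsTwoCut G p q A B) : IsTwoCut G p q B A :=
  ⟨h.ne, h.3, h.2, fun z => by have := h.4 z; tauto, h.6, h.5, h.8, h.7, h.9.symm,
    fun x hx y hy hxy => h.10 y hy x hx hxy.symm⟩

omit [Fintype V] [DecidableEq V] in
lemma swap_cut (h : IsTwoCut G p q A B) : IsTwoCut G q p A B :=
  ⟨h.ne.symm, h.2, h.3, fun z => by have := h.4 z; tauto, h.7, h.8, h.5, h.6, h.9, h.10⟩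

lemma neighborFinset_subset (h : IsTwoCut G p q A B) {a : V} (ha : a ∈ A) :
    G.neighborFinset a ⊆ insert p (insert q (A.erase a)) := by
  intro z hz
  rw [mem_neighborFinset] at hz
  simp only [Finset.mem_insert, Finset.mem_erase]
  rcases h.cover z with rfl | rfl | hzA | hzB
  · simp
  · simp
  · exact Or.inr (Or.inr ⟨hz.ne', hzA⟩)
  · exact absurd hz (h.not_adj a ha z hzB)

omit [Fintype V] in
lemma card_insert (h : IsTwoCut G p q A B) {a : V} (ha : a ∈ A) :
    (insert p (insert q (A.erase a))).card = A.card + 1 := by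
  rw [Finset.card_insert_of_notMem, Finset.card_insert_of_notMem, Finset.card_erase_of_mem ha]
  · have := Finset.card_pos.2 h.left_nonempty
    omega
  · simp [h.snd_notMem_left]
  · simp [h.ne, h.fst_notMem_left]

lemma degree_le (h : IsTwoCut G p q A B) {a : V} (ha : a ∈ A) : G.degree a ≤ A.card + 1 := by
  rw [← h.card_insert ha, ← card_neighborFinset_eq_degree]
  exact Finset.card_le_card (h.neighborFinset_subset ha)

lemma card_eq (h : IsTwoCut G p q A B) : Fintype.card V = A.card + B.card + 2 := by
  have : (Finset.univ : Finset V) = insert p (insert q (A ∪ B)) := by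
    ext z
    have := h.cover z
    simp only [Finset.mem_univ, Finset.mem_insert, Finset.mem_union, true_iff]
    tauto
  rw [← Finset.card_univ, this, Finset.card_insert_of_notMem, Finset.card_insert_of_notMem,
    Finset.card_union_of_disjoint h.disj]
  · simp [h.snd_notMem_left, h.snd_notMem_right]
  · simp [h.ne, h.fst_notMem_left, h.fst_notMem_right]

lemma card_left (h : IsTwoCut G p q A B) (hδ : ∀ x, Fintype.card V ≤ 2 * G.degree x) :
    Fintype.card V = 2 * A.card + 2 := by
  obtain ⟨a, ha⟩ := h.left_nonempty
  obtain ⟨b, hb⟩ := h.right_nonempty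
  have h1 := h.degree_le ha
  have h2 := h.swap_sides.degree_le hb
  have h3 := h.card_eq
  have h4 := hδ a
  have h5 := hδ b
  omega

lemma adj (h : IsTwoCut G p q A B) (hδ : ∀ x, Fintype.card V ≤ 2 * G.degree x) {a z : V}
    (ha : a ∈ A) (hz : z ∈ insert p (insert q A)) (hza : a ≠ z) : G.Adj a z := by
  have : G.neighborFinset a = insert p (insert q (A.erase a)) := by
    refine Finset.eq_of_subset_of_card_le (h.neighborFinset_subset ha) ?_
    rw [h.card_insert ha, card_neighborFinset_eq_degree]
    have := hδ a
    have := h.card_left hδ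
    omega
  rw [← mem_neighborFinset, this]
  simp only [Finset.mem_insert, Finset.mem_erase] at hz ⊢
  have := hza.symm
  tauto

lemma isChain_toList (h : IsTwoCut G p q A B) (hδ : ∀ x, Fintype.card V ≤ 2 * G.degree x)
    {A' : Finset V} (hA' : A' ⊆ A) : A'.toList.IsChain G.Adj := by
  refine List.Pairwise.isChain ?_
  refine (Finset.nodup_toList A').imp_of_mem fun {x y} hx hy hxy => ?_
  rw [Finset.mem_toList] at hx hy
  exact h.adj hδ (hA' hx) (by simp [hA' hy]) hxy

lemma exists_isCycle (h : IsTwoCut G p q A B) (hn : 5 ≤ Fintype.card V)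
    (hδ : ∀ x, Fintype.card V ≤ 2 * G.degree x) {a : V} (ha : a ∈ A) :
    ∃ (v : V) (c : G.Walk v v), c.IsCycle ∧ ∀ x, x ∈ c.support ↔ x ∉ ({a} : Finset V) := by
  have hA := h.card_left hδ
  have hB := h.swap_sides.card_left hδ
  have hl1 : (A.erase a).toList ≠ [] := by
    intro h0
    have := congrArg List.length h0
    rw [Finset.length_toList, Finset.card_erase_of_mem ha, List.length_nil] at this
    omega
  have hl2 : B.toList ≠ [] := by simpa using h.right_nonempty.ne_empty
  have hnd : (p :: (A.erase a).toList ++ q :: B.toList).Nodup := by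
    rw [List.nodup_append, List.nodup_cons, List.nodup_cons]
    simp only [Finset.mem_toList, Finset.nodup_toList, and_true]
    refine ⟨by simp [h.fst_notMem_left], h.snd_notMem_right, ?_⟩
    intro x hx y hy hxy
    subst hxy
    simp only [List.mem_cons, Finset.mem_toList, Finset.mem_erase] at hx hy
    rcases hx with rfl | hx <;> rcases hy with rfl | hy
    · exact h.ne rfl
    · exact h.fst_notMem_right hy
    · exact h.snd_notMem_left hx.2
    · exact Finset.disjoint_left.1 h.disj hx.2 hy
  have hcyc : IsCycleList G (p :: (A.erase a).toList ++ q :: B.toList) := by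
    refine ⟨⟨hnd, ?_⟩, ?_⟩
    · rw [List.isChain_append, List.isChain_cons, List.isChain_cons]
      refine ⟨⟨?_, h.isChain_toList hδ (Finset.erase_subset _ _)⟩,
        ⟨?_, h.swap_sides.isChain_toList hδ subset_rfl⟩, ?_⟩
      · intro y hy
        have hyA : y ∈ A := by
          have := List.mem_of_mem_head? hy
          rw [Finset.mem_toList] at this
          exact Finset.mem_of_mem_erase this
        refine (h.adj hδ hyA (by simp) ?_).symm
        rintro rfl
        exact h.fst_notMem_left hyA
      · intro y hy
        have hyB : y ∈ B := by
          have := List.mem_of_mem_head? hy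
          rwa [Finset.mem_toList] at this
        refine (h.swap_sides.adj hδ hyB (by simp) ?_).symm
        rintro rfl
        exact h.snd_notMem_right hyB
      · intro x hx y hy
        simp at hy
        subst hy
        rw [← List.singleton_append, List.getLast?_append_of_ne_nil _ hl1] at hx
        have hxA : x ∈ A := by
          have := List.mem_of_getLast? hx
          rw [Finset.mem_toList] at this
          exact Finset.mem_of_mem_erase this
        refine h.adj hδ hxA (by simp) ?_
        rintro rfl
        exact h.snd_notMem_left hxA
    · intro x hx y hy
      simp at hy
      subst hy
      rw [List.append_cons, List.getLast?_append_of_ne_nil _ hl2] at hx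
      have hxB : x ∈ B := by
        have := List.mem_of_getLast? hx
        rwa [Finset.mem_toList] at this
      refine h.swap_sides.adj hδ hxB (by simp) ?_
      rintro rfl
      exact h.fst_notMem_right hxB
  obtain ⟨v, c, hc, hsupp⟩ := hcyc.exists_isCycle (by
    simp only [List.length_append, List.length_cons, Finset.length_toList,
      Finset.card_erase_of_mem ha]
    omega)
  refine ⟨v, c, hc, fun x => ?_⟩
  rw [hsupp]
  simp only [List.mem_append, List.mem_cons, Finset.mem_toList, Finset.mem_erase,
    Finset.mem_singleton]
  constructor
  · rintro ((rfl | hx) | rfl | hx) hxa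
    · exact h.fst_notMem_left (hxa ▸ ha)
    · exact hx.1 hxa
    · exact h.snd_notMem_left (hxa ▸ ha)
    · exact Finset.disjoint_left.1 h.disj ha (hxa ▸ hx)
  · intro hxa
    have := h.cover x
    tauto

omit [Fintype V] in
lemma snd_mem_support (h : IsTwoCut G p q A B) {v : V} {c : G.Walk v v} (hc : c.IsCycle)
    (hA : ∀ x ∈ A, x ∈ c.support) (hB : ∀ x ∈ B, x ∈ c.support) : q ∈ c.support := by
  by_contra hq
  obtain ⟨t, ht, hmem⟩ : ∃ t : List V, t.IsChain G.Adj ∧ ∀ x, x ∈ t ↔ x ∈ c.support ∧ x ≠ p := by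
    by_cases hp : p ∈ c.support
    · have hc' := hc.rotate hp
      have hsupp := (c.rotate p hp).cons_tail_support.symm
      have hnd := hc'.support_nodup
      have hch := (c.rotate p hp).isChain_adj_support
      have hmem : ∀ x, x ∈ (c.rotate p hp).support ↔ x ∈ c.support := by
        intro x; simp
      have hlast := Walk.end_mem_tail_support hc'.not_nil
      rw [hsupp] at hch hmem
      obtain ⟨t, z, ht⟩ := (List.eq_nil_or_concat' (c.rotate p hp).support.tail).resolve_left
        (List.ne_nil_of_mem hlast)
      have hz : z = p := by
        have h1 := (c.rotate p hp).getLast_support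
        have h2 : (c.rotate p hp).support.getLast? = some p := by
          rw [List.getLast?_eq_some_getLast (by simp), h1]
        rw [hsupp, ht, ← List.cons_append, List.getLast?_concat] at h2
        simpa using h2
      subst hz
      rw [ht] at hch hmem hnd
      refine ⟨t, hch.tail.left_of_append, fun x => ?_⟩
      rw [← hmem]
      have : z ∉ t := by
        rw [List.nodup_append] at hnd
        exact fun hz => hnd.2.2 z hz z (by simp) rfl
      simp only [List.mem_cons, List.mem_append, List.not_mem_nil, or_false]
      constructor
      · exact fun hx => ⟨Or.inr (Or.inl hx), fun hxz => this (hxz ▸ hx)⟩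
      · tauto
    · refine ⟨c.support, c.isChain_adj_support, fun x => ⟨fun hx => ⟨hx, ?_⟩, fun hx => hx.1⟩⟩
      rintro rfl
      exact hp hx
  obtain ⟨a, ha⟩ := h.left_nonempty
  obtain ⟨b, hb⟩ := h.right_nonempty
  have hat : a ∈ t := (hmem a).2 ⟨hA a ha, fun e => h.fst_notMem_left (e ▸ ha)⟩
  have hbt : b ∈ t := (hmem b).2 ⟨hB b hb, fun e => h.fst_notMem_right (e ▸ hb)⟩
  rcases forall_mem_or_forall_mem_of_isChain ht h.not_adj (fun x hx => by
    have hx' := (hmem x).1 hx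
    have hxq : x ≠ q := by rintro rfl; exact hq hx'.1
    have := h.cover x
    tauto) with hall | hall
  · exact Finset.disjoint_left.1 h.disj (hall b hbt) hb
  · exact Finset.disjoint_left.1 h.disj ha (hall a hat)

lemma isMinHForceSet (h : IsTwoCut G p q A B) (hn : 5 ≤ Fintype.card V)
    (hδ : ∀ x, Fintype.card V ≤ 2 * G.degree x) :
    IsMinHForceSet G (Finset.univ \ {p, q}) := by
  have hmem : ∀ x, x ∈ Finset.univ \ ({p, q} : Finset V) ↔ x ∈ A ∨ x ∈ B := by
    intro x
    simp only [Finset.mem_sdiff, Finset.mem_univ, true_and, Finset.mem_insert,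
      Finset.mem_singleton]
    constructor
    · have := h.cover x
      tauto
    · rintro (hx | hx) (rfl | rfl)
      · exact h.fst_notMem_left hx
      · exact h.snd_notMem_left hx
      · exact h.fst_notMem_right hx
      · exact h.snd_notMem_right hx
  refine ⟨⟨?_, fun v c hc hsub => ?_⟩, fun Y hY => Finset.card_le_card fun x hx => ?_⟩
  · obtain ⟨a, ha⟩ := h.left_nonempty
    exact ⟨a, (hmem a).2 (Or.inl ha)⟩
  · have hA : ∀ x ∈ A, x ∈ c.support := fun x hx => hsub x ((hmem x).2 (Or.inl hx))
    have hB : ∀ x ∈ B, x ∈ c.support := fun x hx => hsub x ((hmem x).2 (Or.inr hx))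
    refine isHamiltonianCycle_of_forall_mem_support hc fun x => ?_
    rcases h.cover x with rfl | rfl | hx | hx
    · exact h.swap_cut.snd_mem_support hc hA hB
    · exact h.snd_mem_support hc hA hB
    · exact hA x hx
    · exact hB x hx
  · have : ∃ y ∈ Y, y ∈ ({x} : Finset V) := by
      refine hY.exists_mem_of_isCycle ⟨x, by simp⟩ ?_
      rcases (hmem x).1 hx with hx | hx
      · exact h.exists_isCycle hn hδ hx
      · exact h.swap_sides.exists_isCycle hn hδ hx
    simpa using this

end IsTwoCut

omit [Fintype V] [DecidableEq V] in
lemma not_sup_edge_adj {u v x y : V} (hG : ¬ G.Adj x y)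
    (h1 : ¬ (x = u ∧ y = v)) (h2 : ¬ (x = v ∧ y = u)) : ¬ (G ⊔ SimpleGraph.edge u v).Adj x y := by
  rw [SimpleGraph.sup_adj, SimpleGraph.edge_adj]
  tauto

omit [DecidableEq V] in
lemma le_of_reflTransGen_weakStep (h : Relation.ReflTransGen WeakStep G Gw) : G ≤ Gw := by
  induction h with
  | refl => exact le_rfl
  | tail _ hs ih =>
    obtain ⟨u, v, -, -, -, rfl⟩ := hs
    exact ih.trans le_sup_left

lemma indep_of_reflTransGen_weakStep {S : Finset V} (hcard : Fintype.card V ≤ 2 * S.card)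
    (hS : ∀ x ∈ S, ∀ y ∈ S, ¬ G.Adj x y) (h : Relation.ReflTransGen WeakStep G Gw) :
    ∀ x ∈ S, ∀ y ∈ S, ¬ Gw.Adj x y := by
  induction h with
  | refl => exact hS
  | tail _ hs ih =>
    obtain ⟨u, v, -, -, hdeg, rfl⟩ := hs
    have huv : ¬ (u ∈ S ∧ v ∈ S) := by
      rintro ⟨hu, hv⟩
      have h1 := (degree_le_card_sub_of_indep ih hu).2
      have h2 := (degree_le_card_sub_of_indep ih hv).2
      have := Finset.card_le_univ S
      omega
    intro x hx y hy
    refine not_sup_edge_adj (ih x hx y hy) ?_ ?_ <;> rintro ⟨rfl, rfl⟩ <;> tauto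

lemma isTwoCut_of_reflTransGen_weakStep {p q : V} {A B : Finset V} (hG : IsTwoCut G p q A B)
    (h : Relation.ReflTransGen WeakStep G Gw) : IsTwoCut Gw p q A B := by
  induction h with
  | refl => exact hG
  | tail _ hs ih =>
    obtain ⟨u, v, -, -, hdeg, rfl⟩ := hs
    have hcard := hG.card_eq
    refine { hG with not_adj := fun x hx y hy => not_sup_edge_adj (ih.not_adj x hx y hy) ?_ ?_ }
      <;> rintro ⟨rfl, rfl⟩
    · have h1 := ih.degree_le hx
      have h2 := ih.swap_sides.degree_le hy
      omega
    · have h1 := ih.degree_le hx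
      have h2 := ih.swap_sides.degree_le hy
      omega

/-- Under Dirac's condition there is a large independent set, a two-vertex cut, or a cycle
missing exactly any prescribed vertex. -/
lemma indep_or_isTwoCut_or_forall_exists_isCycle (hn : 5 ≤ Fintype.card V)
    (hδ : ∀ x, Fintype.card V ≤ 2 * G.degree x) :
    (∃ S : Finset V, Fintype.card V ≤ 2 * S.card ∧ ∀ x ∈ S, ∀ y ∈ S, ¬ G.Adj x y) ∨
    (∃ p q A B, IsTwoCut G p q A B) ∨
    ∀ v : V, ∃ (w : V) (c : G.Walk w w), c.IsCycle ∧ ∀ x, x ∈ c.support ↔ x ∉ ({v} : Finset V) := by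
  by_cases h : ∀ v : V, ∃ (w : V) (c : G.Walk w w), c.IsCycle ∧
      ∀ x, x ∈ c.support ↔ x ∉ ({v} : Finset V)
  · exact Or.inr (Or.inr h)
  push Not at h
  obtain ⟨v, hv⟩ := h
  have key := exists_isCycle_avoiding (G := G) {v} (by simp; omega) (by
    intro x _
    have h1 := Finset.le_card_sdiff {v} (G.neighborFinset x)
    rw [card_neighborFinset_eq_degree] at h1
    have h2 := hδ x
    rw [Finset.card_singleton] at h1 ⊢
    omega)
  rw [Finset.card_singleton] at key
  rcases key with ⟨w, c, hc, hs⟩ | ⟨-, ⟨S, hS, hind⟩ |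
    ⟨q, A, B, hA, hB, hz, hqv, hvA, hvB, hqA, hqB, hd, hAB⟩⟩
  · obtain ⟨x, hx⟩ := hv w c hc
    have := hs x
    tauto
  · exact Or.inl ⟨S, by omega, hind⟩
  · rw [Finset.disjoint_singleton_left] at hvA hvB
    refine Or.inr (Or.inl ⟨v, q, A, B, ?_, hA, hB, fun z => ?_, hvA, hvB, hqA, hqB, hd, hAB⟩)
    · rintro rfl; simp at hqv
    · simpa using hz z

lemma isHForceSet_iff_eq_univ (hn : 5 ≤ Fintype.card V)
    (h : ∀ v : V, ∃ (w : V) (c : G.Walk w w), c.IsCycle ∧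
      ∀ x, x ∈ c.support ↔ x ∉ ({v} : Finset V)) (X : Finset V) :
    IsHForceSet G X ↔ X = Finset.univ := by
  constructor
  · intro hX
    rw [Finset.eq_univ_iff_forall]
    intro v
    simpa using hX.exists_mem_of_isCycle ⟨v, by simp⟩ (h v)
  · rintro rfl
    refine ⟨?_, fun v c hc hsub => isHamiltonianCycle_of_forall_mem_support hc
      fun x => hsub x (Finset.mem_univ x)⟩
    rw [← Finset.card_pos, Finset.card_univ]
    omega

end HForce

/-- For a graph `G` with `n ≥ 5` vertices and `δ(G) ≥ n / 2` (Dirac's condition), with weak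
closure `Gw`: the H-force number is `n - 2`, `n / 2`, or `n`; moreover if `h(G) = n - 2` then
`V(G) \ {x, y}` is a minimum H-force set, where `x, y` are the vertices of degree `n - 1` in
`Gw`; if `h(G) = n / 2` then every largest independent set of `Gw` is a minimum H-force set;
and if `h(G) = n` then `V(G)` is the only H-force set. -/
theorem stmt_10 {V : Type*} [Fintype V] [DecidableEq V] (G Gw : SimpleGraph V)
    (hn : 5 ≤ Fintype.card V) (hδ : Fintype.card V ≤ 2 * G.minDegree)
    (hw : IsWeakClosure G Gw) :
    (hForce G = Fintype.card V - 2 ∨ 2 * hForce G = Fintype.card V ∨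
      hForce G = Fintype.card V) ∧
    (hForce G = Fintype.card V - 2 →
      ∀ x y : V, x ≠ y → Gw.degree x = Fintype.card V - 1 →
        Gw.degree y = Fintype.card V - 1 →
        IsMinHForceSet G (Finset.univ \ {x, y})) ∧
    (2 * hForce G = Fintype.card V →
      ∀ S : Finset V, (∀ x ∈ S, ∀ y ∈ S, ¬Gw.Adj x y) →
        (∀ T : Finset V, (∀ x ∈ T, ∀ y ∈ T, ¬Gw.Adj x y) → T.card ≤ S.card) →
        IsMinHForceSet G S) ∧
    (hForce G = Fintype.card V →
      ∀ X : Finset V, IsHForceSet G X ↔ X = Finset.univ) := by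
  have hδ' : ∀ x, Fintype.card V ≤ 2 * G.degree x := fun x => by
    have := G.minDegree_le_degree x
    omega
  rcases indep_or_isTwoCut_or_forall_exists_isCycle hn hδ' with
    ⟨S, hS, hind⟩ | ⟨p, q, A, B, hcut⟩ | hall
  · obtain ⟨hmin, hcard⟩ := isMinHForceSet_of_indep hn hδ' hind hS
    have hh := hmin.hForce_eq
    refine ⟨by omega, fun h => by omega, fun _ T hT hTmax => ?_, fun h => by omega⟩
    have hST := hTmax S (indep_of_reflTransGen_weakStep hS hind hw.1)
    exact (isMinHForceSet_of_indep hn hδ' (fun x hx y hy hxy =>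
      hT x hx y hy (le_of_reflTransGen_weakStep hw.1 hxy)) (by omega)).1
  · have hmin := hcut.isMinHForceSet hn hδ'
    have hh := hmin.hForce_eq
    rw [Finset.card_sdiff_of_subset (Finset.subset_univ _), Finset.card_univ,
      Finset.card_pair hcut.ne] at hh
    refine ⟨by omega, fun _ x y hxy hx hy => ?_, fun h => by omega, fun h => by omega⟩
    have hcutw := isTwoCut_of_reflTransGen_weakStep hcut hw.1
    have hA := hcut.card_left hδ'
    have hB := hcut.swap_sides.card_left hδ'
    have hfull : ∀ z, Gw.degree z = Fintype.card V - 1 → z = p ∨ z = q := by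
      intro z hz
      rcases hcut.cover z with h | h | h | h
      · exact Or.inl h
      · exact Or.inr h
      · have := hcutw.degree_le h
        omega
      · have := hcutw.swap_sides.degree_le h
        omega
    rcases hfull x hx with rfl | rfl <;> rcases hfull y hy with rfl | rfl
    · exact absurd rfl hxy
    · exact hmin
    · rwa [Finset.pair_comm]
    · exact absurd rfl hxy
  · have hiff := isHForceSet_iff_eq_univ hn hall
    have hmin : IsMinHForceSet G Finset.univ :=
      ⟨(hiff _).2 rfl, fun Y hY => by rw [(hiff Y).1 hY]⟩
    have hh := hmin.hForce_eq
    rw [Finset.card_univ] at hh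
    exact ⟨by omega, fun h => by omega, fun h => by omega, fun _ => hiff⟩
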